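/- arXiv:1207.6424 — 5 statements merged into one kernel-verified Lean document; each statement's English description precedes it below -/
import Mathlib

section
/- Let O be a commutative ring, π ∈ O, and let M be an O-module such that every element of M is annihilated by some power of π. Let T denote the O-module of sequences (x_n)_{n≥1} with x_n ∈ M, π^n • x_n = 0, and π • x_{n+1} = x_n for all n (the inverse limit lim_n M[π^n] along the multiplication-by-π transition maps), and let M̃ denote the O-module of sequences (y_n)_{n≥1} with y_n ∈ M and π • y_{n+1} = y_n for all n (the inverse limit lim_π M). Then the componentwise inclusion g : T → M̃ exhibits M̃ as the localization of T at the multiplicative set of powers of π; explicitly: multiplication by π is bijective on M̃, for every y ∈ M̃ there exist k ≥ 0 and x ∈ T with π^k • y = g(x), and T is π-torsion-free (so g becomes injective after localization, and g itself is injective). -/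
/-- In a sequence compatible under multiplication by `π`, the `n`-th term is an `n`-fold
`π`-division of the initial term. -/
theorem pow_smul_eq_zeroth_of_compatible {O M : Type*} [Monoid O] [MulAction O M]
    {π : O} {y : ℕ → M} (hy : ∀ n, π • y (n + 1) = y n) (n : ℕ) : π ^ n • y n = y 0 := by
  induction n with
  | zero => simp
  | succ n ih => rw [pow_succ, mul_smul, hy, ih]

/-- Multiplication by `π` is bijective on `lim_π M`. -/
theorem bijective_smul_of_mem_iff_compatible {O M : Type*} [CommRing O] [AddCommGroup M]
    [Module O M] {π : O} {N : Submodule O (ℕ → M)}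
    (hN : ∀ y : ℕ → M, y ∈ N ↔ ∀ n : ℕ, π • y (n + 1) = y n) :
    Function.Bijective (fun y : N => π • y) := by
  constructor
  · intro y z h
    ext n
    rw [← (hN y).1 y.2 n, ← (hN z).1 z.2 n]
    exact congrFun (congrArg Subtype.val h) (n + 1)
  · intro y
    refine ⟨⟨fun n => y.1 (n + 1), (hN _).2 fun n => (hN y).1 y.2 (n + 1)⟩, ?_⟩
    ext n
    exact (hN y).1 y.2 n


/-- The module-theoretic content of the paper's lemma on universal covers:
if every element of the `O`-module `M` is annihilated by a power of `π`, then the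
componentwise inclusion `g` of `T = lim_n M[π^n]` into `M̃ = lim_π M` exhibits `M̃`
as the localization of `T` at the powers of `π`; moreover `g` is injective. -/
theorem stmt0 (O : Type*) [CommRing O] (π : O) (M : Type*) [AddCommGroup M] [Module O M]
    (htors : ∀ m : M, ∃ k : ℕ, π ^ k • m = 0)
    (T Mt : Submodule O (ℕ → M))
    (hT : ∀ x : ℕ → M, x ∈ T ↔ (∀ n : ℕ, π ^ (n + 1) • x n = 0 ∧ π • x (n + 1) = x n))
    (hMt : ∀ y : ℕ → M, y ∈ Mt ↔ ∀ n : ℕ, π • y (n + 1) = y n)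
    (g : T →ₗ[O] Mt) (hg : ∀ x : T, (g x : ℕ → M) = (x : ℕ → M)) :
    IsLocalizedModule (Submonoid.powers π) g ∧ Function.Injective g := by
  have hinj : Function.Injective g := fun x y h =>
    Subtype.ext ((hg x).symm.trans ((congrArg Subtype.val h).trans (hg y)))
  refine ⟨⟨?_, ?_, fun h => ⟨1, by rw [hinj h]⟩⟩, hinj⟩
  · rintro ⟨_, k, rfl⟩
    have hπ : IsUnit (algebraMap O (Module.End O Mt) π) :=
      (Module.End.isUnit_iff _).2 (bijective_smul_of_mem_iff_compatible hMt)
    simpa only [map_pow] using hπ.pow k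
  · intro y
    have hy := (hMt y).1 y.2
    obtain ⟨k, hk⟩ := htors (y.1 0)
    have hmem : π ^ k • y.1 ∈ T := by
      refine (hT _).2 fun n => ⟨?_, (hMt _).1 (Mt.smul_mem _ y.2) n⟩
      rw [Pi.smul_apply, smul_comm, pow_succ', mul_smul,
        pow_smul_eq_zeroth_of_compatible hy, smul_comm, hk, smul_zero]
    exact ⟨(⟨_, hmem⟩, ⟨π ^ k, k, rfl⟩), Subtype.ext (hg ⟨_, hmem⟩).symm⟩
end

section
/- Let p be a prime, q a power of p, R a commutative ring of characteristic p, and N ⊆ R a nilpotent ideal (N^M = 0 for some M ≥ 1). Then reduction modulo N induces a bijection from the set of sequences (x_i)_{i≥0} of nilpotent elements of R satisfying x_{i+1}^q = x_i for all i, onto the set of sequences (y_i)_{i≥0} of nilpotent elements of R/N satisfying y_{i+1}^q = y_i for all i. The inverse is the Teichmüller lift: choosing arbitrary lifts r_j ∈ R of y_j, the sequence (r_{i+k}^{q^k})_{k≥0} is eventually constant and its stable value x_i defines the unique preimage. -/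
/-- In characteristic `p`, elements congruent modulo an ideal with `N ^ M = 0` have the same
`q ^ M`-th power, for `q` a positive power of `p`. -/
theorem pow_pow_eq_of_sub_mem_of_pow_eq_bot {R : Type*} [CommRing R] {p e M : ℕ}
    [Fact p.Prime] [CharP R p] (he : 0 < e) {N : Ideal R} (hN : N ^ M = ⊥) {u v : R}
    (h : u - v ∈ N) : u ^ (p ^ e) ^ M = v ^ (p ^ e) ^ M := by
  have hq : 1 < p ^ e := Nat.one_lt_pow he.ne' (Fact.out : p.Prime).one_lt
  have hmem : (u - v) ^ (p ^ e) ^ M ∈ N ^ M :=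
    Ideal.pow_le_pow_right (Nat.lt_pow_self hq).le (Ideal.pow_mem_pow h _)
  rw [hN, Ideal.mem_bot, ← pow_mul, sub_pow_char_pow] at hmem
  rw [← pow_mul]
  exact sub_eq_zero.mp hmem

/-- In a sequence with `x (i + 1) ^ q = x i`, the element `x i` is the `q ^ k`-th power of
`x (i + k)`. -/
theorem pow_pow_eq_of_pow_succ_eq {S : Type*} [Monoid S] {q : ℕ} {x : ℕ → S}
    (hx : ∀ i, x (i + 1) ^ q = x i) (i k : ℕ) : x (i + k) ^ q ^ k = x i := by
  induction k with
  | zero => simp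
  | succ k ih => rw [pow_succ', pow_mul, ← add_assoc, hx, ih]

/-- An element that is nilpotent modulo a nilpotent ideal is nilpotent. -/
theorem isNilpotent_of_isNilpotent_mk {R : Type*} [CommRing R] {N : Ideal R} {M : ℕ}
    (hN : N ^ M = ⊥) {a : R} (h : IsNilpotent (Ideal.Quotient.mk N a)) : IsNilpotent a := by
  obtain ⟨n, hn⟩ := h
  rw [← map_pow, Ideal.Quotient.eq_zero_iff_mem] at hn
  refine ⟨n * M, ?_⟩
  rw [pow_mul, ← Ideal.mem_bot, ← hN]
  exact Ideal.pow_mem_pow hn M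


/-- Reduction modulo a nilpotent ideal `N` of a commutative ring `R` of characteristic `p`
induces a bijection between sequences of nilpotent elements `x` with `x (i+1) ^ q = x i`
in `R` and such sequences in `R ⧸ N` (the inverse being the Teichmüller lift). -/
theorem stmt1 (p : ℕ) (hp : p.Prime) (e : ℕ) (he : 0 < e) (q : ℕ) (hq : q = p ^ e)
    (R : Type*) [CommRing R] (hchar : CharP R p)
    (N : Ideal R) (M : ℕ) (hM : 1 ≤ M) (hN : N ^ M = ⊥) :
    Set.BijOn (fun (x : ℕ → R) (i : ℕ) => Ideal.Quotient.mk N (x i))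
      {x : ℕ → R | (∀ i, IsNilpotent (x i)) ∧ ∀ i, x (i + 1) ^ q = x i}
      {y : ℕ → R ⧸ N | (∀ i, IsNilpotent (y i)) ∧ ∀ i, y (i + 1) ^ q = y i} := by
  subst hq
  have : Fact p.Prime := ⟨hp⟩
  refine ⟨?_, ?_, ?_⟩
  · rintro x ⟨hnil, hx⟩
    exact ⟨fun i => (hnil i).map _, fun i => by simp only [← map_pow, hx]⟩
  · rintro x ⟨-, hx⟩ x' ⟨-, hx'⟩ h
    funext i
    rw [← pow_pow_eq_of_pow_succ_eq hx i M, ← pow_pow_eq_of_pow_succ_eq hx' i M]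
    exact pow_pow_eq_of_sub_mem_of_pow_eq_bot he hN
      (Ideal.Quotient.eq.mp (congrFun h (i + M)))
  · rintro y ⟨hnil, hy⟩
    choose r hr using fun i => Ideal.Quotient.mk_surjective (I := N) (y i)
    have hmk : ∀ i, Ideal.Quotient.mk N (r (i + M) ^ (p ^ e) ^ M) = y i := fun i => by
      rw [map_pow, hr, pow_pow_eq_of_pow_succ_eq hy]
    refine ⟨fun i => r (i + M) ^ (p ^ e) ^ M, ⟨fun i => ?_, fun i => ?_⟩, funext hmk⟩
    · exact isNilpotent_of_isNilpotent_mk hN (by rw [hmk]; exact hnil i)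
    · dsimp only
      rw [pow_right_comm]
      refine pow_pow_eq_of_sub_mem_of_pow_eq_bot he hN (Ideal.Quotient.eq.mp ?_)
      rw [map_pow, hr, hr, add_right_comm, hy]
end

section
/- Let R be a commutative ring, N ⊆ R a nilpotent ideal, and f ∈ R[X] a polynomial with constant coefficient 0 whose coefficient of X lies in N. If (x_i)_{i≥1} is a sequence of elements of N such that f(x_{i+1}) = x_i for all i ≥ 1, then x_i = 0 for all i. (The key point is that f maps N^m into N^{m+1} for every m ≥ 1, so x_i = f^{∘k}(x_{i+k}) ∈ N^{k+1} for all k.) -/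
/-- A polynomial without constant term whose linear coefficient lies in `N` maps `N ^ (m + 1)`
into `N ^ (m + 2)`. -/
theorem Polynomial.eval_mem_pow_succ_of_coeff_one_mem {R : Type*} [CommRing R] {N : Ideal R}
    {f : Polynomial R} (h0 : f.coeff 0 = 0) (h1 : f.coeff 1 ∈ N) {m : ℕ} {a : R}
    (ha : a ∈ N ^ (m + 1)) : f.eval a ∈ N ^ (m + 2) := by
  have haN : a ∈ N := Ideal.pow_le_self m.succ_ne_zero ha
  have key : f.eval a = a * (a * f.divX.divX.eval a + f.coeff 1) := by
    conv_lhs => rw [← f.X_mul_divX_add, ← f.divX.X_mul_divX_add]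
    simp [h0, Polynomial.coeff_divX]
  rw [key, pow_succ]
  exact Ideal.mul_mem_mul ha (N.add_mem (N.mul_mem_right _ haN) h1)

/-- If `N` is a nilpotent ideal of a commutative ring `R` and `f` is a polynomial with
constant coefficient `0` whose linear coefficient lies in `N`, then any sequence of
elements of `N` with `f (x (i+1)) = x i` is identically zero. -/
theorem stmt2 (R : Type*) [CommRing R] (N : Ideal R) (M : ℕ) (hM : 1 ≤ M) (hN : N ^ M = ⊥)
    (f : Polynomial R) (h0 : f.coeff 0 = 0) (h1 : f.coeff 1 ∈ N)
    (x : ℕ → R) (hx : ∀ i, x i ∈ N) (hf : ∀ i, f.eval (x (i + 1)) = x i) :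
    ∀ i, x i = 0 := by
  have mem_pow (k : ℕ) : ∀ i, x i ∈ N ^ (k + 1) := by
    induction k with
    | zero => simpa using hx
    | succ k ih =>
      intro i
      rw [← hf i]
      exact Polynomial.eval_mem_pow_succ_of_coeff_one_mem h0 h1 (ih (i + 1))
  intro i
  have hi := mem_pow (M - 1) i
  rwa [Nat.sub_add_cancel hM, hN, Ideal.mem_bot] at hi
end

section
/- Let p be a prime and let A be a reduced commutative ring of characteristic p. Let I = (y₁,…,y_r) be a finitely generated ideal of A such that each generator y_i admits a p^m-th root in A for every m ≥ 1. Assume that A is I-adically complete and separated (the natural map A → lim_k A/I^k is an isomorphism), and that the Frobenius endomorphism x ↦ x^p is surjective on A/I. Then the Frobenius endomorphism of A is bijective, i.e. A is a perfect ring. -/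
/-- Precompleteness passes from an ideal to any larger ideal some power of which it contains. -/
theorem IsPrecomplete.of_le_of_pow_le {R : Type*} [CommRing R] {I J : Ideal R}
    (hI : IsPrecomplete I R) (hIJ : I ≤ J) {N : ℕ} (hN : J ^ N ≤ I) : IsPrecomplete J R := by
  have hN' : J ^ (N + 1) ≤ I := (Ideal.pow_le_pow_right N.le_succ).trans hN
  refine ⟨fun f hf ↦ ?_⟩
  simp only [SModEq.sub_mem, smul_eq_mul, Ideal.mul_top] at hf ⊢
  obtain ⟨L, hL⟩ := hI.prec (f := fun m ↦ f ((N + 1) * m)) (by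
    intro m n hmn
    simp only [SModEq.sub_mem, smul_eq_mul, Ideal.mul_top]
    have h := hf (Nat.mul_le_mul_left (N + 1) hmn)
    rw [pow_mul] at h
    exact Ideal.pow_right_mono hN' m h)
  simp only [SModEq.sub_mem, smul_eq_mul, Ideal.mul_top] at hL
  refine ⟨L, fun n ↦ ?_⟩
  have h := add_mem (hf (Nat.le_mul_of_pos_left n N.succ_pos)) (Ideal.pow_right_mono hIJ n (hL n))
  simpa using h

/-- If `A` is a reduced commutative ring of characteristic `p`, `I` is an ideal generated
by finitely many elements each admitting `p^m`-th roots for all `m`, `A` is `I`-adically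
complete and separated, and Frobenius is surjective on `A ⧸ I`, then Frobenius is
bijective on `A`, i.e. `A` is perfect. -/
theorem stmt5 (p : ℕ) (hp : p.Prime) (A : Type*) [CommRing A] [CharP A p] [IsReduced A]
    (r : ℕ) (y : Fin r → A) (I : Ideal A) (hI : I = Ideal.span (Set.range y))
    (hroot : ∀ i : Fin r, ∀ m : ℕ, ∃ z : A, z ^ p ^ m = y i)
    (hcomplete : IsAdicComplete I A)
    (hsurj : Function.Surjective (fun x : A ⧸ I => x ^ p)) :
    Function.Bijective (fun x : A => x ^ p) := by
  have : Fact p.Prime := ⟨hp⟩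
  have : ExpChar A p := ExpChar.prime hp
  refine ⟨frobenius_inj A p, ?_⟩
  choose z hz using fun i ↦ hroot i 1
  simp only [pow_one] at hz
  let J : Ideal A := Ideal.span (Set.range z)
  have hmap : J.map (frobenius A p) = I := by
    rw [hI, Ideal.map_span, ← Set.range_comp]
    congr 2
    exact funext hz
  have hIJ : I ≤ J := by
    rw [hI, Ideal.span_le]
    rintro _ ⟨i, rfl⟩
    rw [← hz i]
    exact J.pow_mem_of_mem (Ideal.subset_span ⟨i, rfl⟩) p hp.pos
  have hrad : J ≤ I.radical := by
    refine Ideal.span_le.2 ?_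
    rintro _ ⟨i, rfl⟩
    refine ⟨p, ?_⟩
    rw [hz i, hI]
    exact Ideal.subset_span ⟨i, rfl⟩
  obtain ⟨N, hN⟩ := Ideal.exists_pow_le_of_le_radical_of_fg hrad
    (Submodule.fg_span (Set.finite_range z))
  have : IsPrecomplete J A := hcomplete.toIsPrecomplete.of_le_of_pow_le hIJ hN
  have : IsHausdorff (J.map (frobenius A p)) A := hmap ▸ hcomplete.toIsHausdorff
  refine surjective_of_mk_map_comp_surjective (I := J) (frobenius A p) ?_
  rw [hmap]
  intro x
  obtain ⟨w, hw⟩ := hsurj x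
  obtain ⟨a, rfl⟩ := Ideal.Quotient.mk_surjective w
  exact ⟨a, by simpa [frobenius_def] using hw⟩
end

section
/- Let p be a prime, A a perfect commutative ring of characteristic p (i.e. the Frobenius x ↦ x^p is bijective on A), B a reduced commutative ring, and φ : A → B a ring homomorphism. Let t ∈ A and assume that ker φ ⊆ tA and that ⋂_{m≥0} t^{p^m} A = 0. Then φ is injective. -/
/-- If `A` is a perfect commutative ring of characteristic `p` (Frobenius is bijective),
`B` is reduced, and `φ : A →+* B` has kernel contained in `(t)` where
`⋂ₘ (t ^ p ^ m) = 0`, then `φ` is injective. -/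
theorem stmt6 (p : ℕ) (hp : p.Prime) (A B : Type*) [CommRing A] [CommRing B] [CharP A p]
    (hperf : Function.Bijective (fun x : A => x ^ p)) [IsReduced B]
    (φ : A →+* B) (t : A) (hker : RingHom.ker φ ≤ Ideal.span {t})
    (hsep : (⨅ m : ℕ, Ideal.span {t ^ p ^ m}) = (⊥ : Ideal A)) :
    Function.Injective φ := by
  rw [injective_iff_map_eq_zero]
  intro a ha
  rw [← Ideal.mem_bot, ← hsep, Ideal.mem_iInf]
  intro m
  obtain ⟨b, rfl⟩ : ∃ b : A, b ^ p ^ m = a := by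
    obtain ⟨b, hb⟩ := hperf.surjective.iterate m a
    exact ⟨b, by rwa [pow_iterate] at hb⟩
  have hb : φ b = 0 := eq_zero_of_pow_eq_zero (by rwa [map_pow] at ha)
  rw [Ideal.mem_span_singleton]
  exact pow_dvd_pow_of_dvd (Ideal.mem_span_singleton.mp (hker hb)) _
end
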